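/- arXiv:1211.3219 — 2 statements merged into one kernel-verified Lean document; each statement's English description precedes it below -/
import Mathlib

section
/- For any smooth positive function g(q) on R^n, the bracket {q_i, q_j}_g = 0, {q_i, p_j}_g = g δ_{ij}, {p_i, p_j}_g = (∂g/∂q_j) p_i − (∂g/∂q_i) p_j on R^{2n} satisfies the Jacobi identity, i.e. defines a Poisson structure. -/
open scoped BigOperators
noncomputable section

variable {n : ℕ}

/-- Partial derivative in the q (inl) or p (inr) direction on ℝⁿ × ℝⁿ. -/
def pdN : (Fin n ⊕ Fin n) → ((Fin n → ℝ) × (Fin n → ℝ) → ℝ) →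
    (Fin n → ℝ) × (Fin n → ℝ) → ℝ
  | .inl i, F, x => fderiv ℝ F x (Pi.single i 1, 0)
  | .inr i, F, x => fderiv ℝ F x (0, Pi.single i 1)

/-- Bracket of two functions determined by a structure matrix π. -/
def pbN (π : (Fin n → ℝ) × (Fin n → ℝ) → (Fin n ⊕ Fin n) → (Fin n ⊕ Fin n) → ℝ)
    (F G : (Fin n → ℝ) × (Fin n → ℝ) → ℝ) (x : (Fin n → ℝ) × (Fin n → ℝ)) : ℝ :=
  ∑ u, ∑ v, π x u v * pdN u F x * pdN v G x

/-- Structure matrix of the deformed canonical bracket: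
{q_i,q_j} = 0, {q_i,p_j} = g δ_ij, {p_i,p_j} = ∂_j g p_i - ∂_i g p_j. -/
def piQP (g : (Fin n → ℝ) → ℝ) (x : (Fin n → ℝ) × (Fin n → ℝ)) :
    (Fin n ⊕ Fin n) → (Fin n ⊕ Fin n) → ℝ
  | .inl _, .inl _ => 0
  | .inl i, .inr j => if i = j then g x.1 else 0
  | .inr i, .inl j => -(if i = j then g x.1 else 0)
  | .inr i, .inr j =>
      fderiv ℝ g x.1 (Pi.single j 1) * x.2 i - fderiv ℝ g x.1 (Pi.single i 1) * x.2 j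

lemma alg_rot {ι : Type*} [Fintype ι] (f : ι → ι → ι → ℝ) :
    ∑ z, ∑ u, ∑ v, f z u v = ∑ z, ∑ u, ∑ v, f u v z := by
  rw [Finset.sum_comm (f := fun z u => ∑ v, f u v z)]
  refine Finset.sum_congr rfl fun w _ => ?_
  rw [Finset.sum_comm]

lemma alg_term {ι : Type*} [Fintype ι] (π : ι → ι → ℝ) (hπ : ∀ u v, π u v = - π v u)
    (D : ι → ι → ι → ℝ) (a b c : ι → ℝ) (B C : ι → ι → ℝ) :
    ∑ z, ∑ w, π z w * a z * (∑ u, ∑ v, (D w u v * b u * c v + π u v * B w u * c v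
      + π u v * b u * C w v)) =
    (∑ z, ∑ u, ∑ v, (∑ w, π z w * D w u v) * (a z * b u * c v))
    - ∑ w, ∑ u, (∑ z, π z w * a z) * B w u * (∑ v, π v u * c v)
    + ∑ w, ∑ v, (∑ z, π z w * a z) * C w v * (∑ u, π u v * b u) := by
  have h1 : ∑ z, ∑ u, ∑ v, (∑ w, π z w * D w u v) * (a z * b u * c v)
      = ∑ z, ∑ w, π z w * a z * (∑ u, ∑ v, D w u v * b u * c v) := by
    refine Finset.sum_congr rfl fun z _ => ?_
    simp only [Finset.mul_sum, Finset.sum_mul]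
    rw [alg_rot]
    refine Finset.sum_congr rfl fun w _ => Finset.sum_congr rfl fun u _ =>
      Finset.sum_congr rfl fun v _ => ?_
    ring
  have h2 : ∑ w, ∑ u, (∑ z, π z w * a z) * B w u * (∑ v, π v u * c v)
      = - ∑ z, ∑ w, π z w * a z * (∑ u, ∑ v, π u v * B w u * c v) := by
    rw [Finset.sum_comm (f := fun z w => π z w * a z * (∑ u, ∑ v, π u v * B w u * c v)),
      ← Finset.sum_neg_distrib]
    refine Finset.sum_congr rfl fun w _ => ?_
    rw [← Finset.sum_mul, ← mul_neg, ← Finset.sum_neg_distrib, Finset.mul_sum]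
    refine Finset.sum_congr rfl fun u _ => ?_
    rw [mul_assoc, ← Finset.sum_neg_distrib, Finset.mul_sum]
    congr 1
    refine Finset.sum_congr rfl fun v _ => ?_
    rw [hπ v u]; ring
  have h3 : ∑ w, ∑ v, (∑ z, π z w * a z) * C w v * (∑ u, π u v * b u)
      = ∑ z, ∑ w, π z w * a z * (∑ u, ∑ v, π u v * b u * C w v) := by
    rw [Finset.sum_comm (f := fun z w => π z w * a z * (∑ u, ∑ v, π u v * b u * C w v))]
    refine Finset.sum_congr rfl fun w _ => ?_
    rw [← Finset.sum_mul, Finset.sum_comm (f := fun u v => π u v * b u * C w v), Finset.mul_sum]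
    refine Finset.sum_congr rfl fun u _ => ?_
    rw [mul_assoc, Finset.mul_sum]
    congr 1
    refine Finset.sum_congr rfl fun v _ => ?_
    ring
  rw [h1, h2, h3, sub_neg_eq_add, ← Finset.sum_add_distrib, ← Finset.sum_add_distrib]
  refine Finset.sum_congr rfl fun z _ => ?_
  rw [← Finset.sum_add_distrib, ← Finset.sum_add_distrib]
  refine Finset.sum_congr rfl fun w _ => ?_
  simp only [Finset.sum_add_distrib]
  ring

lemma alg_hess {ι : Type*} [Fintype ι] (C : ι → ι → ℝ) (hC : ∀ u v, C u v = C v u)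
    (X Y : ι → ℝ) : ∑ w, ∑ v, X w * C w v * Y v = ∑ w, ∑ v, Y w * C w v * X v := by
  rw [Finset.sum_comm]
  refine Finset.sum_congr rfl fun w _ => Finset.sum_congr rfl fun v _ => ?_
  rw [hC]; ring

lemma alg_jacobi {ι : Type*} [Fintype ι] (π : ι → ι → ℝ) (hπ : ∀ u v, π u v = - π v u)
    (D : ι → ι → ι → ℝ)
    (hJ : ∀ z u v, ∑ w, π z w * D w u v + ∑ w, π u w * D w v z + ∑ w, π v w * D w z u = 0)
    (a b c : ι → ℝ) (A B C : ι → ι → ℝ) (hA : ∀ u v, A u v = A v u)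
    (hB : ∀ u v, B u v = B v u) (hC : ∀ u v, C u v = C v u) :
    ∑ z, ∑ w, π z w * a z * (∑ u, ∑ v, (D w u v * b u * c v + π u v * B w u * c v
      + π u v * b u * C w v)) +
    ∑ z, ∑ w, π z w * b z * (∑ u, ∑ v, (D w u v * c u * a v + π u v * C w u * a v
      + π u v * c u * A w v)) +
    ∑ z, ∑ w, π z w * c z * (∑ u, ∑ v, (D w u v * a u * b v + π u v * A w u * b v
      + π u v * a u * B w v)) = 0 := by
  rw [alg_term π hπ, alg_term π hπ, alg_term π hπ]
  rw [alg_hess A hA (fun w => ∑ z, π z w * c z), alg_hess B hB (fun w => ∑ z, π z w * a z),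
    alg_hess C hC (fun w => ∑ z, π z w * b z)]
  have key : (∑ z, ∑ u, ∑ v, (∑ w, π z w * D w u v) * (a z * b u * c v))
    + (∑ z, ∑ u, ∑ v, (∑ w, π z w * D w u v) * (b z * c u * a v))
    + (∑ z, ∑ u, ∑ v, (∑ w, π z w * D w u v) * (c z * a u * b v)) = 0 := by
    rw [alg_rot (fun z u v => (∑ w, π z w * D w u v) * (b z * c u * a v)),
      alg_rot (fun z u v => (∑ w, π z w * D w u v) * (c z * a u * b v)),
      alg_rot (fun z u v => (∑ w, π u w * D w v z) * (c u * a v * b z))]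
    simp only [← Finset.sum_add_distrib]
    refine Finset.sum_eq_zero fun z _ => Finset.sum_eq_zero fun u _ =>
      Finset.sum_eq_zero fun v _ => ?_
    linear_combination (a z * b u * c v) * hJ z u v
  linear_combination key

/-- direction vectors -/
def dirN : (Fin n ⊕ Fin n) → (Fin n → ℝ) × (Fin n → ℝ)
  | .inl i => (Pi.single i 1, 0)
  | .inr i => (0, Pi.single i 1)

lemma pdN_eq (u : Fin n ⊕ Fin n) (F : (Fin n → ℝ) × (Fin n → ℝ) → ℝ) (x) :
    pdN u F x = fderiv ℝ F x (dirN u) := by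
  cases u <;> rfl

lemma pdN_contDiff (u : Fin n ⊕ Fin n) {F : (Fin n → ℝ) × (Fin n → ℝ) → ℝ}
    (hF : ContDiff ℝ (⊤ : ℕ∞) F) : ContDiff ℝ (⊤ : ℕ∞) (pdN u F) := by
  have : pdN u F = fun x => fderiv ℝ F x (dirN u) := funext (pdN_eq u F)
  rw [this]
  exact (hF.fderiv_right (m := (⊤ : ℕ∞)) (by simp)).clm_apply contDiff_const

lemma pdN_symm (u v : Fin n ⊕ Fin n) {F : (Fin n → ℝ) × (Fin n → ℝ) → ℝ}
    (hF : ContDiff ℝ (⊤ : ℕ∞) F) (x) : pdN u (pdN v F) x = pdN v (pdN u F) x := by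
  have hd : DifferentiableAt ℝ (fderiv ℝ F) x :=
    ((hF.fderiv_right (m := (⊤ : ℕ∞)) (by simp)).differentiable (by simp)) x
  have h : ∀ a b : Fin n ⊕ Fin n,
      pdN a (pdN b F) x = fderiv ℝ (fderiv ℝ F) x (dirN a) (dirN b) := by
    intro a b
    rw [pdN_eq, show pdN b F = fun x => fderiv ℝ F x (dirN b) from funext (pdN_eq b F)]
    rw [fderiv_clm_apply hd (differentiableAt_const _)]
    simp
  rw [h, h]
  exact (hF.contDiffAt.isSymmSndFDerivAt (by simp; exact WithTop.coe_le_coe.2 (le_top : (2 : ℕ∞) ≤ ⊤))) _ _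

lemma piQP_contDiff {g : (Fin n → ℝ) → ℝ} (hg : ContDiff ℝ (⊤ : ℕ∞) g) (u v : Fin n ⊕ Fin n) :
    ContDiff ℝ (⊤ : ℕ∞) (fun x => piQP g x u v) := by
  have h1 : ContDiff ℝ (⊤ : ℕ∞) (fun x : (Fin n → ℝ) × (Fin n → ℝ) => g x.1) :=
    hg.comp contDiff_fst
  have h2 : ∀ i, ContDiff ℝ (⊤ : ℕ∞)
      (fun x : (Fin n → ℝ) × (Fin n → ℝ) => fderiv ℝ g x.1 (Pi.single i 1)) := fun i =>
    ((hg.fderiv_right (m := (⊤ : ℕ∞)) (by simp)).comp contDiff_fst).clm_apply contDiff_const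
  have h3 : ∀ i, ContDiff ℝ (⊤ : ℕ∞)
      (fun x : (Fin n → ℝ) × (Fin n → ℝ) => x.2 i) := fun i => by fun_prop
  rcases u with i | i <;> rcases v with j | j <;> simp only [piQP]
  · exact contDiff_const
  · split_ifs
    · exact h1
    · exact contDiff_const
  · split_ifs
    · exact h1.neg
    · exact contDiff_const
  · exact ((h2 j).mul (h3 i)).sub ((h2 i).mul (h3 j))

lemma piQP_anti (g : (Fin n → ℝ) → ℝ) (x) (u v : Fin n ⊕ Fin n) :
    piQP g x u v = - piQP g x v u := by
  rcases u with i | i <;> rcases v with j | j <;> simp [piQP, eq_comm]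

/-- derivative of the bracket -/
lemma pdN_pbN {g : (Fin n → ℝ) → ℝ} (hg : ContDiff ℝ (⊤ : ℕ∞) g)
    {G K : (Fin n → ℝ) × (Fin n → ℝ) → ℝ}
    (hG : ContDiff ℝ (⊤ : ℕ∞) G) (hK : ContDiff ℝ (⊤ : ℕ∞) K) (w) (x) :
    pdN w (pbN (piQP g) G K) x = ∑ u, ∑ v, (pdN w (fun y => piQP g y u v) x * pdN u G x * pdN v K x
      + piQP g x u v * pdN w (pdN u G) x * pdN v K x
      + piQP g x u v * pdN u G x * pdN w (pdN v K) x) := by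
  have dπ : ∀ u v, HasFDerivAt (fun y => piQP g y u v) (fderiv ℝ (fun y => piQP g y u v) x) x :=
    fun u v => ((piQP_contDiff hg u v).differentiable (by simp) x).hasFDerivAt
  have dd : ∀ {F : (Fin n → ℝ) × (Fin n → ℝ) → ℝ}, ContDiff ℝ (⊤ : ℕ∞) F → ∀ u,
      HasFDerivAt (pdN u F) (fderiv ℝ (pdN u F) x) x :=
    fun hF u => ((pdN_contDiff u hF).differentiable (by simp) x).hasFDerivAt
  have H := HasFDerivAt.fun_sum (u := Finset.univ) fun u _ =>
    HasFDerivAt.fun_sum (u := Finset.univ) fun v _ => ((dπ u v).mul (dd hG u)).mul (dd hK v)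
  have H' : fderiv ℝ (pbN (piQP g) G K) x = _ := H.fderiv
  rw [pdN_eq, H']
  simp only [sum_apply]
  refine Finset.sum_congr rfl fun u _ => Finset.sum_congr rfl fun v _ => ?_
  simp [pdN_eq w]
  ring

/-- second derivative of g -/
lemma pd_dg {g : (Fin n → ℝ) → ℝ} (hg : ContDiff ℝ (⊤ : ℕ∞) g) (x : (Fin n → ℝ) × (Fin n → ℝ))
    (i j : Fin n) :
    HasFDerivAt (fun y : (Fin n → ℝ) × (Fin n → ℝ) =>
      fderiv ℝ g y.1 (Pi.single j 1) * y.2 i - fderiv ℝ g y.1 (Pi.single i 1) * y.2 j)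
      (((fderiv ℝ g x.1 (Pi.single j 1)) •
          ((ContinuousLinearMap.proj (R := ℝ) (φ := fun _ : Fin n => ℝ) i).comp
            (ContinuousLinearMap.snd ℝ _ _))
        + x.2 i • (((fderiv ℝ (fderiv ℝ g) x.1).flip (Pi.single j 1)).comp
            (ContinuousLinearMap.fst ℝ _ _)))
      - ((fderiv ℝ g x.1 (Pi.single i 1)) •
          ((ContinuousLinearMap.proj (R := ℝ) (φ := fun _ : Fin n => ℝ) j).comp
            (ContinuousLinearMap.snd ℝ _ _))
        + x.2 j • (((fderiv ℝ (fderiv ℝ g) x.1).flip (Pi.single i 1)).comp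
            (ContinuousLinearMap.fst ℝ _ _)))) x := by
  have hp : ∀ i, HasFDerivAt (fun y : (Fin n → ℝ) × (Fin n → ℝ) => y.2 i)
      ((ContinuousLinearMap.proj (R := ℝ) (φ := fun _ : Fin n => ℝ) i).comp
            (ContinuousLinearMap.snd ℝ _ _)) x := fun i =>
    ((ContinuousLinearMap.proj (R := ℝ) (φ := fun _ : Fin n => ℝ) i).comp
            (ContinuousLinearMap.snd ℝ (Fin n → ℝ) (Fin n → ℝ))).hasFDerivAt
  have hd : DifferentiableAt ℝ (fderiv ℝ g) x.1 :=
    ((hg.fderiv_right (m := (⊤ : ℕ∞)) (by simp)).differentiable (by simp)) x.1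
  have hq : ∀ i : Fin n, HasFDerivAt (fun y : (Fin n → ℝ) × (Fin n → ℝ) =>
      fderiv ℝ g y.1 (Pi.single i 1)) (((fderiv ℝ (fderiv ℝ g) x.1).flip (Pi.single i 1)).comp
            (ContinuousLinearMap.fst ℝ _ _)) x := fun i => by
    have h1 : HasFDerivAt (fun q => fderiv ℝ g q (Pi.single i 1))
        ((fderiv ℝ (fderiv ℝ g) x.1).flip (Pi.single i 1)) x.1 := by
      have := hd.hasFDerivAt.clm_apply (hasFDerivAt_const (Pi.single i (1:ℝ) : Fin n → ℝ) x.1)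
      simpa using this
    exact h1.comp x hasFDerivAt_fst
  exact ((hq j).mul (hp i)).sub ((hq i).mul (hp j))

lemma pdN_piQP {g : (Fin n → ℝ) → ℝ} (hg : ContDiff ℝ (⊤ : ℕ∞) g)
    (x : (Fin n → ℝ) × (Fin n → ℝ)) :
    (∀ w i j, pdN w (fun y => piQP g y (.inl i) (.inl j)) x = 0) ∧
    (∀ k i j, pdN (.inl k) (fun y => piQP g y (.inl i) (.inr j)) x
      = if i = j then fderiv ℝ g x.1 (Pi.single k 1) else 0) ∧
    (∀ k i j, pdN (.inr k) (fun y => piQP g y (.inl i) (.inr j)) x = 0) ∧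
    (∀ k i j, pdN (.inl k) (fun y => piQP g y (.inr i) (.inl j)) x
      = - if i = j then fderiv ℝ g x.1 (Pi.single k 1) else 0) ∧
    (∀ k i j, pdN (.inr k) (fun y => piQP g y (.inr i) (.inl j)) x = 0) ∧
    (∀ k i j, pdN (.inl k) (fun y => piQP g y (.inr i) (.inr j)) x
      = fderiv ℝ (fderiv ℝ g) x.1 (Pi.single k 1) (Pi.single j 1) * x.2 i
       - fderiv ℝ (fderiv ℝ g) x.1 (Pi.single k 1) (Pi.single i 1) * x.2 j) ∧
    (∀ k i j, pdN (.inr k) (fun y => piQP g y (.inr i) (.inr j)) x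
      = fderiv ℝ g x.1 (Pi.single j 1) * (if i = k then 1 else 0)
       - fderiv ℝ g x.1 (Pi.single i 1) * (if j = k then 1 else 0)) := by
  have hgx : HasFDerivAt (fun y : (Fin n → ℝ) × (Fin n → ℝ) => g y.1)
      ((fderiv ℝ g x.1).comp (ContinuousLinearMap.fst ℝ _ _)) x :=
    ((hg.differentiable (by simp)) x.1).hasFDerivAt.comp x hasFDerivAt_fst
  have hgn := hgx.neg
  refine ⟨?_, ?_, ?_, ?_, ?_, ?_, ?_⟩
  · intro w i j
    simp [pdN_eq, piQP]
  · intro k i j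
    by_cases h : i = j
    · simp [pdN_eq, piQP, h, hgx.fderiv, dirN]
    · simp [pdN_eq, piQP, h]
  · intro k i j
    by_cases h : i = j
    · simp [pdN_eq, piQP, h, hgx.fderiv, dirN]
    · simp [pdN_eq, piQP, h]
  · intro k i j
    by_cases h : i = j
    · simp [pdN_eq, piQP, h, hgx.fderiv, dirN]
    · simp [pdN_eq, piQP, h]
  · intro k i j
    by_cases h : i = j
    · simp [pdN_eq, piQP, h, hgx.fderiv, dirN]
    · simp [pdN_eq, piQP, h]
  · intro k i j
    simp only [pdN_eq, piQP]
    rw [(pd_dg hg x i j).fderiv]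
    simp [dirN]
    ring
  · intro k i j
    simp only [pdN_eq, piQP]
    rw [(pd_dg hg x i j).fderiv]
    simp [dirN, Pi.single_apply]

lemma piQP_jacobi {g : (Fin n → ℝ) → ℝ} (hg : ContDiff ℝ (⊤ : ℕ∞) g)
    (x : (Fin n → ℝ) × (Fin n → ℝ)) (z u v : Fin n ⊕ Fin n) :
    ∑ w, piQP g x z w * pdN w (fun y => piQP g y u v) x
    + ∑ w, piQP g x u w * pdN w (fun y => piQP g y v z) x
    + ∑ w, piQP g x v w * pdN w (fun y => piQP g y z u) x = 0 := by
  obtain ⟨h1, h2, h3, h4, h5, h6, h7⟩ := pdN_piQP hg x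
  have hs : ∀ a b, fderiv ℝ (fderiv ℝ g) x.1 a b = fderiv ℝ (fderiv ℝ g) x.1 b a := fun a b =>
    (hg.contDiffAt.isSymmSndFDerivAt (by simp; exact WithTop.coe_le_coe.2 (le_top : (2 : ℕ∞) ≤ ⊤))) a b
  rcases z with i | i <;> rcases u with j | j <;> rcases v with k | k <;>
    simp only [Fintype.sum_sum_type, h1, h2, h3, h4, h5, h6, h7] <;>
    simp [piQP, mul_sub, Finset.sum_sub_distrib, Finset.sum_add_distrib, Finset.sum_neg_distrib]
  case inr.inr.inr =>
    rw [hs (Pi.single j 1) (Pi.single i 1), hs (Pi.single k 1) (Pi.single i 1),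
      hs (Pi.single k 1) (Pi.single j 1)]
    ring
  all_goals grind

/-- for any smooth positive g on ℝⁿ the deformed canonical bracket
satisfies the Jacobi identity, i.e. defines a Poisson structure on ℝ²ⁿ. -/
theorem jacobi_identity_deformed_canonical
    (n : ℕ) (g : (Fin n → ℝ) → ℝ) (hg : ContDiff ℝ (⊤ : ℕ∞) g) (hgpos : ∀ q, 0 < g q)
    (F G K : (Fin n → ℝ) × (Fin n → ℝ) → ℝ)
    (hF : ContDiff ℝ (⊤ : ℕ∞) F) (hG : ContDiff ℝ (⊤ : ℕ∞) G) (hK : ContDiff ℝ (⊤ : ℕ∞) K)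
    (x : (Fin n → ℝ) × (Fin n → ℝ)) :
    pbN (piQP g) F (pbN (piQP g) G K) x +
    pbN (piQP g) G (pbN (piQP g) K F) x +
    pbN (piQP g) K (pbN (piQP g) F G) x = 0 := by
  have key : ∀ F G : (Fin n → ℝ) × (Fin n → ℝ) → ℝ, pbN (piQP g) F G x
      = ∑ z, ∑ w, piQP g x z w * pdN z F x * pdN w G x := fun _ _ => rfl
  rw [key F, key G, key K]
  simp only [pdN_pbN hg hG hK, pdN_pbN hg hK hF, pdN_pbN hg hF hG]
  exact alg_jacobi (piQP g x) (piQP_anti g x) (fun w u v => pdN w (fun y => piQP g y u v) x)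
    (piQP_jacobi hg x) (fun u => pdN u F x) (fun u => pdN u G x) (fun u => pdN u K x)
    (fun w u => pdN w (pdN u F) x) (fun w u => pdN w (pdN u G) x) (fun w u => pdN w (pdN u K) x)
    (fun u v => pdN_symm u v hF x) (fun u v => pdN_symm u v hG x) (fun u v => pdN_symm u v hK x)
end
end

section
/- The change of variables L_i(γ, M) given by L_1 = g^{-1}(M_1 − b γ_1 (1 + γ_3²/ν)/(γ,γ)) + c γ_1/(γ_1²+γ_2²), L_2 = g^{-1}(M_2 − b γ_2 (1 + γ_3²/ν)/(γ,γ)) + c γ_2/(γ_1²+γ_2²), L_3 = g^{-1}(M_3 − b γ_3 (1 − (γ_1²+γ_2²)/ν)/(γ,γ)), with b = (γ, M), ν = γ_1² + γ_2² − d(γ,γ)(a_1γ_1² + a_2γ_2²) and c determined by c = (γ, L), transforms the deformed bracket {·,·}_g into the canonical Lie–Poisson bracket on e*(3): {L_i, L_j}_g = ε_{ijk} L_k, {L_i, γ_j}_g = ε_{ijk} γ_k, {γ_i, γ_j}_g = 0. -/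
open scoped BigOperators
noncomputable section

/-- ℝ³ as functions `Fin 3 → ℝ`. -/
abbrev R3 := Fin 3 → ℝ

/-- Phase space: pairs `(γ, M)`. -/
abbrev St := R3 × R3

/-- Standard scalar product in ℝ³. -/
def dot3 (x y : R3) : ℝ := ∑ i, x i * y i

/-- Cross product in ℝ³. -/
def cross (x y : R3) : R3 :=
  ![x 1 * y 2 - x 2 * y 1, x 2 * y 0 - x 0 * y 2, x 0 * y 1 - x 1 * y 0]

/-- Levi-Civita symbol. -/
def eps (i j k : Fin 3) : ℝ :=
  ((((j : ℤ) - (i : ℤ)) * ((k : ℤ) - (i : ℤ)) * ((k : ℤ) - (j : ℤ))) / 2 : ℤ)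

/-- Application of the diagonal matrix A = diag a. -/
def Aapp (a : R3) (v : R3) : R3 := fun i => a i * v i

/-- Angular velocity ω expressed through M. -/
def omg (a : R3) (d : ℝ) (x : St) : R3 := fun i =>
  a i * x.2 i + d * dot3 x.1 (Aapp a x.2) / (1 - d * dot3 x.1 (Aapp a x.1)) * (a i * x.1 i)

/-- g(γ) = sqrt(1 - d (γ, Aγ)). -/
def gfun (a : R3) (d : ℝ) (γ : R3) : ℝ := Real.sqrt (1 - d * dot3 γ (Aapp a γ))

/-- Partial derivative in the γ (inl) or M (inr) direction. -/
def pd : (Fin 3 ⊕ Fin 3) → (St → ℝ) → St → ℝ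
  | .inl i, F, x => fderiv ℝ F x (Pi.single i 1, 0)
  | .inr i, F, x => fderiv ℝ F x (0, Pi.single i 1)

/-- Bracket of two functions determined by a structure matrix π. -/
def pb (π : St → (Fin 3 ⊕ Fin 3) → (Fin 3 ⊕ Fin 3) → ℝ) (F G : St → ℝ) (x : St) : ℝ :=
  ∑ u, ∑ v, π x u v * pd u F x * pd v G x

/-- Structure matrix of the bracket {·,·}_g. -/
def piG (a : R3) (d : ℝ) (x : St) : (Fin 3 ⊕ Fin 3) → (Fin 3 ⊕ Fin 3) → ℝ
  | .inl _, .inl _ => 0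
  | .inl i, .inr j => ∑ k, eps i j k * gfun a d x.1 * x.1 k
  | .inr i, .inl j => ∑ k, eps i j k * gfun a d x.1 * x.1 k
  | .inr i, .inr j => ∑ k, eps i j k *
      (gfun a d x.1 * x.2 k - d * dot3 x.2 (Aapp a x.1) * x.1 k / gfun a d x.1)

/-- Coordinate functions on the phase space. -/
def coordFn : (Fin 3 ⊕ Fin 3) → St → ℝ
  | .inl i => fun x => x.1 i
  | .inr i => fun x => x.2 i

/-- ν = γ₁² + γ₂² - d(γ,γ)(a₁γ₁² + a₂γ₂²). -/
def nuf (a : R3) (d : ℝ) (γ : R3) : ℝ :=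
  γ 0 ^ 2 + γ 1 ^ 2 - d * dot3 γ γ * (a 0 * γ 0 ^ 2 + a 1 * γ 1 ^ 2)

/-- The change of variables L = L(γ, M) (with parameter c) reducing {·,·}_g to the
canonical Lie-Poisson bracket on e*(3). -/
def Lvar (a : R3) (d c : ℝ) (i : Fin 3) (x : St) : ℝ :=
  ![ (gfun a d x.1)⁻¹ * (x.2 0 - dot3 x.1 x.2 * x.1 0 / dot3 x.1 x.1 *
        (1 + x.1 2 ^ 2 / nuf a d x.1)) + c * x.1 0 / (x.1 0 ^ 2 + x.1 1 ^ 2),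
     (gfun a d x.1)⁻¹ * (x.2 1 - dot3 x.1 x.2 * x.1 1 / dot3 x.1 x.1 *
        (1 + x.1 2 ^ 2 / nuf a d x.1)) + c * x.1 1 / (x.1 0 ^ 2 + x.1 1 ^ 2),
     (gfun a d x.1)⁻¹ * (x.2 2 - dot3 x.1 x.2 * x.1 2 / dot3 x.1 x.1 *
        (1 - (x.1 0 ^ 2 + x.1 1 ^ 2) / nuf a d x.1)) ] i


/-- simplified `q` -/
def qf (a : R3) (γ : R3) : ℝ := a 0 * γ 0 ^ 2 + a 1 * γ 1 ^ 2

def wf (a : R3) (d : ℝ) (i : Fin 3) (γ : R3) : ℝ :=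
  ![γ 0 * (1 - d * qf a γ), γ 1 * (1 - d * qf a γ), - (γ 2 * (d * qf a γ))] i * (nuf a d γ)⁻¹

def uf (i : Fin 3) (γ : R3) : ℝ := ![γ 0, γ 1, 0] i * (γ 0 ^ 2 + γ 1 ^ 2)⁻¹

def Lsim (a : R3) (d c : ℝ) (i : Fin 3) (x : St) : ℝ :=
  (gfun a d x.1)⁻¹ * (x.2 i - dot3 x.1 x.2 * wf a d i x.1) + c * uf i x.1

lemma L_eq (a : R3) (d c : ℝ) (i : Fin 3) (x : St) (hs : 0 < x.1 0 ^ 2 + x.1 1 ^ 2)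
    (hnu : nuf a d x.1 ≠ 0) : Lvar a d c i x = Lsim a d c i x := by
  have hn : dot3 x.1 x.1 ≠ 0 := by
    simp only [dot3, Fin.sum_univ_three]
    nlinarith [sq_nonneg (x.1 2)]
  have e1 : (1 + x.1 2 ^ 2 / nuf a d x.1) = dot3 x.1 x.1 * (1 - d * qf a x.1) * (nuf a d x.1)⁻¹ := by
    field_simp
    simp only [nuf, qf, dot3, Fin.sum_univ_three]; ring
  have e2 : (1 - (x.1 0 ^ 2 + x.1 1 ^ 2) / nuf a d x.1)
      = dot3 x.1 x.1 * (- (d * qf a x.1)) * (nuf a d x.1)⁻¹ := by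
    field_simp
    simp only [nuf, qf, dot3, Fin.sum_univ_three]; ring
  simp only [Lvar, Lsim, e1, e2, wf, uf]
  generalize dot3 x.1 x.1 = n at *
  fin_cases i <;> simp <;> field_simp <;> simp

/-- derivative of q along `v` -/
def dq (a γ v : R3) : ℝ := 2 * (a 0 * γ 0 * v 0 + a 1 * γ 1 * v 1)

def dnu (a : R3) (d : ℝ) (γ v : R3) : ℝ :=
  2 * (γ 0 * v 0 + γ 1 * v 1) - d * (2 * dot3 γ v) * qf a γ - d * dot3 γ γ * dq a γ v

def dw (a : R3) (d : ℝ) (i : Fin 3) (γ v : R3) : ℝ :=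
  ![v 0 * (1 - d * qf a γ) - γ 0 * (d * dq a γ v), v 1 * (1 - d * qf a γ) - γ 1 * (d * dq a γ v),
    - (v 2 * (d * qf a γ) + γ 2 * (d * dq a γ v))] i * (nuf a d γ)⁻¹
  - wf a d i γ * (nuf a d γ)⁻¹ * dnu a d γ v

def du (i : Fin 3) (γ v : R3) : ℝ :=
  ![v 0, v 1, 0] i * (γ 0 ^ 2 + γ 1 ^ 2)⁻¹
  - uf i γ * (γ 0 ^ 2 + γ 1 ^ 2)⁻¹ * (2 * (γ 0 * v 0 + γ 1 * v 1))

def dL (a : R3) (d c : ℝ) (i : Fin 3) (x v : St) : ℝ :=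
  (gfun a d x.1)⁻¹ * ((1 - d * dot3 x.1 (Aapp a x.1))⁻¹ * (d * dot3 v.1 (Aapp a x.1)) *
    (x.2 i - dot3 x.1 x.2 * wf a d i x.1)
   + (v.2 i - (dot3 x.1 v.2 + dot3 v.1 x.2) * wf a d i x.1 - dot3 x.1 x.2 * dw a d i x.1 v.1))
  + c * du i x.1 v.1

lemma hasLD (a : R3) (d c : ℝ) (i : Fin 3) (x v : St)
    (hg : 0 < 1 - d * dot3 x.1 (Aapp a x.1))
    (hs : 0 < x.1 0 ^ 2 + x.1 1 ^ 2)
    (hnu : nuf a d x.1 ≠ 0) : HasLineDerivAt ℝ (Lsim a d c i) (dL a d c i x v) x v := by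
  have h1 : ∀ k, HasDerivAt (fun t : ℝ => (x + t • v).1 k) (v.1 k) 0 := fun k => by
    simpa using ((hasDerivAt_id (0:ℝ)).mul_const (v.1 k)).const_add (x.1 k)
  have h2 : ∀ k, HasDerivAt (fun t : ℝ => (x + t • v).2 k) (v.2 k) 0 := fun k => by
    simpa using ((hasDerivAt_id (0:ℝ)).mul_const (v.2 k)).const_add (x.2 k)
  have z1 : ∀ k, (x + (0:ℝ) • v).1 k = x.1 k := fun k => by simp
  have z2 : ∀ k, (x + (0:ℝ) • v).2 k = x.2 k := fun k => by simp
  have z3 : (x + (0:ℝ) • v).1 = x.1 := by simp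
  have z4 : (x + (0:ℝ) • v).2 = x.2 := by simp
  have hb : HasDerivAt (fun t : ℝ => dot3 (x + t • v).1 (x + t • v).2)
      (dot3 x.1 v.2 + dot3 v.1 x.2) 0 := by
    simp only [dot3, Fin.sum_univ_three]
    refine ((((h1 0).mul (h2 0)).add ((h1 1).mul (h2 1))).add ((h1 2).mul (h2 2))).congr_deriv ?_
    simp only [z1, z2]; ring
  have hq : HasDerivAt (fun t : ℝ => qf a (x + t • v).1) (dq a x.1 v.1) 0 := by
    simp only [qf]
    refine ((((h1 0).pow 2).const_mul (a 0)).add (((h1 1).pow 2).const_mul (a 1))).congr_deriv ?_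
    simp only [z1, dq]; push_cast; ring
  have hss : HasDerivAt (fun t : ℝ => (x + t • v).1 0 ^ 2 + (x + t • v).1 1 ^ 2)
      (2 * (x.1 0 * v.1 0 + x.1 1 * v.1 1)) 0 := by
    refine (((h1 0).pow 2).add ((h1 1).pow 2)).congr_deriv ?_
    simp only [z1]; push_cast; ring
  have hn : HasDerivAt (fun t : ℝ => dot3 (x + t • v).1 (x + t • v).1)
      (2 * dot3 x.1 v.1) 0 := by
    simp only [dot3, Fin.sum_univ_three]
    refine ((((h1 0).mul (h1 0)).add ((h1 1).mul (h1 1))).add ((h1 2).mul (h1 2))).congr_deriv ?_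
    simp only [z1]; ring
  have hN : HasDerivAt (fun t : ℝ => nuf a d (x + t • v).1) (dnu a d x.1 v.1) 0 := by
    refine (hss.sub ((hn.const_mul d).mul hq)).congr_deriv ?_
    simp only [z3, dnu]; ring
  have hNi : HasDerivAt (fun t : ℝ => (nuf a d (x + t • v).1)⁻¹)
      (-(dnu a d x.1 v.1) / (nuf a d x.1) ^ 2) 0 := by
    have := hN.fun_inv (by rw [z3]; exact hnu)
    rwa [z3] at this
  have hsi : HasDerivAt (fun t : ℝ => ((x + t • v).1 0 ^ 2 + (x + t • v).1 1 ^ 2)⁻¹)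
      (-(2 * (x.1 0 * v.1 0 + x.1 1 * v.1 1)) / (x.1 0 ^ 2 + x.1 1 ^ 2) ^ 2) 0 := by
    have := hss.fun_inv (by rw [z3]; exact hs.ne')
    rwa [z3] at this
  have hw : HasDerivAt (fun t : ℝ => wf a d i (x + t • v).1) (dw a d i x.1 v.1) 0 := by
    simp only [wf, dw]
    fin_cases i
    · refine (((h1 0).mul ((hq.const_mul d).const_sub 1)).mul hNi).congr_deriv ?_
      simp only [z1, z3, Pi.mul_apply]; simp; ring
    · refine (((h1 1).mul ((hq.const_mul d).const_sub 1)).mul hNi).congr_deriv ?_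
      simp only [z1, z3, Pi.mul_apply]; simp; ring
    · refine ((((h1 2).mul ((hq.const_mul d))).neg).mul hNi).congr_deriv ?_
      simp only [z1, z3, Pi.mul_apply, Pi.neg_apply]; simp; ring
  have hu : HasDerivAt (fun t : ℝ => uf i (x + t • v).1) (du i x.1 v.1) 0 := by
    simp only [uf, du]
    fin_cases i
    · refine ((h1 0).mul hsi).congr_deriv ?_
      simp only [z1]; simp; field_simp; ring
    · refine ((h1 1).mul hsi).congr_deriv ?_
      simp only [z1]; simp; field_simp; ring
    · simpa using hasDerivAt_const (0:ℝ) (0:ℝ)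
  have hG : HasDerivAt (fun t : ℝ => 1 - d * dot3 (x + t • v).1 (Aapp a (x + t • v).1))
      (-(2 * d * dot3 v.1 (Aapp a x.1))) 0 := by
    simp only [dot3, Aapp, Fin.sum_univ_three]
    refine (((((h1 0).mul ((h1 0).const_mul (a 0))).add ((h1 1).mul ((h1 1).const_mul (a 1)))).add
      ((h1 2).mul ((h1 2).const_mul (a 2)))).const_mul d |>.const_sub 1).congr_deriv ?_
    simp only [z1]; ring
  have hgp : 0 < gfun a d x.1 := Real.sqrt_pos.2 hg
  have hg2 : gfun a d x.1 ^ 2 = 1 - d * dot3 x.1 (Aapp a x.1) := Real.sq_sqrt hg.le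
  have hgi : HasDerivAt (fun t : ℝ => (gfun a d (x + t • v).1)⁻¹)
      ((gfun a d x.1)⁻¹ * ((1 - d * dot3 x.1 (Aapp a x.1))⁻¹ * (d * dot3 v.1 (Aapp a x.1)))) 0 := by
    have := (hG.sqrt (by rw [z3]; exact hg.ne')).fun_inv
      (by rw [z3]; exact hgp.ne')
    refine this.congr_deriv ?_
    rw [z3]
    change -(_ / (2 * gfun a d x.1)) / (gfun a d x.1) ^ 2 = _
    rw [← hg2]; field_simp
  have := (hgi.mul ((h2 i).sub (hb.mul hw))).add (hu.const_mul c)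
  refine HasDerivAt.congr_deriv this ?_
  simp only [z2, z3, z4, dL, Pi.mul_apply, Pi.sub_apply]; ring

lemma pdL (a : R3) (d c : ℝ) (i : Fin 3) (x : St)
    (hg : 0 < 1 - d * dot3 x.1 (Aapp a x.1))
    (hs : 0 < x.1 0 ^ 2 + x.1 1 ^ 2)
    (hnu : nuf a d x.1 ≠ 0) (v : St) : fderiv ℝ (Lvar a d c i) x v = dL a d c i x v := by
  have e : Lvar a d c i =ᶠ[nhds x] Lsim a d c i := by
    have c1 : Continuous fun y : St => y.1 0 ^ 2 + y.1 1 ^ 2 := by fun_prop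
    have c2 : Continuous fun y : St => nuf a d y.1 := by unfold nuf dot3; fun_prop
    filter_upwards [c1.continuousAt.eventually (lt_mem_nhds hs),
      c2.continuousAt.eventually_ne hnu] with y h1 h2 using L_eq a d c i y h1 h2
  rw [e.fderiv_eq]
  have hD : DifferentiableAt ℝ (Lsim a d c i) x := by
    have hgp : gfun a d x.1 ≠ 0 := (Real.sqrt_pos.2 hg).ne'
    have dn : DifferentiableAt ℝ (fun y : St => nuf a d y.1) x := by
      unfold nuf dot3; fun_prop
    have dg : DifferentiableAt ℝ (fun y : St => gfun a d y.1) x := by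
      unfold gfun
      refine DifferentiableAt.sqrt ?_ hg.ne'
      unfold dot3 Aapp; fun_prop
    have dS : DifferentiableAt ℝ (fun y : St => (y.1 0 ^ 2 + y.1 1 ^ 2)⁻¹) x :=
      DifferentiableAt.fun_inv (by fun_prop) hs.ne'
    have dN := dn.fun_inv hnu
    have dgi := dg.fun_inv hgp
    have dw : DifferentiableAt ℝ (fun y : St => wf a d i y.1) x := by
      unfold wf
      refine DifferentiableAt.fun_mul ?_ dN
      unfold qf
      fin_cases i <;> simp <;> fun_prop
    have du : DifferentiableAt ℝ (fun y : St => uf i y.1) x := by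
      unfold uf
      refine DifferentiableAt.fun_mul ?_ dS
      fin_cases i <;> simp <;> fun_prop
    have db : DifferentiableAt ℝ (fun y : St => dot3 y.1 y.2) x := by
      unfold dot3; fun_prop
    unfold Lsim
    fun_prop
  rw [← hD.lineDeriv_eq_fderiv]
  exact (hasLD a d c i x v hg hs hnu).lineDeriv

lemma eps_vals : eps 0 0 0 = 0 ∧ eps 0 0 1 = 0 ∧ eps 0 0 2 = 0 ∧ eps 0 1 0 = 0 ∧ eps 0 1 1 = 0 ∧
    eps 0 1 2 = 1 ∧ eps 0 2 0 = 0 ∧ eps 0 2 1 = -1 ∧ eps 0 2 2 = 0 ∧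
    eps 1 0 0 = 0 ∧ eps 1 0 1 = 0 ∧ eps 1 0 2 = -1 ∧ eps 1 1 0 = 0 ∧ eps 1 1 1 = 0 ∧
    eps 1 1 2 = 0 ∧ eps 1 2 0 = 1 ∧ eps 1 2 1 = 0 ∧ eps 1 2 2 = 0 ∧
    eps 2 0 0 = 0 ∧ eps 2 0 1 = 1 ∧ eps 2 0 2 = 0 ∧ eps 2 1 0 = -1 ∧ eps 2 1 1 = 0 ∧
    eps 2 1 2 = 0 ∧ eps 2 2 0 = 0 ∧ eps 2 2 1 = 0 ∧ eps 2 2 2 = 0 := by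
  norm_num [eps]

lemma eps_anti (i j k : Fin 3) : eps i j k = - eps j i k := by
  fin_cases i <;> fin_cases j <;> fin_cases k <;> simp [eps_vals]

lemma piG_anti (a : R3) (d : ℝ) (x : St) (u v) : piG a d x u v = - piG a d x v u := by
  rcases u with i | i <;> rcases v with j | j <;>
    simp only [piG, neg_zero, ← Finset.sum_neg_distrib] <;>
    refine Finset.sum_congr rfl fun k _ => ?_ <;> rw [eps_anti i j k] <;> ring

lemma pb_anti (a : R3) (d : ℝ) (x : St) (F G : St → ℝ) :
    pb (piG a d) F G x = - pb (piG a d) G F x := by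
  unfold pb
  rw [Finset.sum_comm]
  simp only [← Finset.sum_neg_distrib]
  refine Finset.sum_congr rfl fun u _ => Finset.sum_congr rfl fun v _ => ?_
  rw [piG_anti]; ring

/-- The bracket, written out. -/
lemma pb_expand (a : R3) (d : ℝ) (x : St) (F G : St → ℝ) :
    pb (piG a d) F G x =
    gfun a d x.1 * (
      x.1 2 * (pd (.inr 0) F x * pd (.inl 1) G x - pd (.inr 1) F x * pd (.inl 0) G x
        + pd (.inl 0) F x * pd (.inr 1) G x - pd (.inl 1) F x * pd (.inr 0) G x)
      + x.1 0 * (pd (.inr 1) F x * pd (.inl 2) G x - pd (.inr 2) F x * pd (.inl 1) G x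
        + pd (.inl 1) F x * pd (.inr 2) G x - pd (.inl 2) F x * pd (.inr 1) G x)
      + x.1 1 * (pd (.inr 2) F x * pd (.inl 0) G x - pd (.inr 0) F x * pd (.inl 2) G x
        + pd (.inl 2) F x * pd (.inr 0) G x - pd (.inl 0) F x * pd (.inr 2) G x))
    + ((gfun a d x.1 * x.2 2 - d * dot3 x.2 (Aapp a x.1) * x.1 2 / gfun a d x.1) *
        (pd (.inr 0) F x * pd (.inr 1) G x - pd (.inr 1) F x * pd (.inr 0) G x)
      + (gfun a d x.1 * x.2 0 - d * dot3 x.2 (Aapp a x.1) * x.1 0 / gfun a d x.1) *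
        (pd (.inr 1) F x * pd (.inr 2) G x - pd (.inr 2) F x * pd (.inr 1) G x)
      + (gfun a d x.1 * x.2 1 - d * dot3 x.2 (Aapp a x.1) * x.1 1 / gfun a d x.1) *
        (pd (.inr 2) F x * pd (.inr 0) G x - pd (.inr 0) F x * pd (.inr 2) G x)) := by
  simp only [pb, Fintype.sum_sum_type, Fin.sum_univ_three, piG, eps_vals]
  ring

lemma pd_coord_l (i j : Fin 3) (x : St) :
    pd (.inl i) (coordFn (.inl j)) x = if j = i then 1 else 0 := by
  have h : coordFn (.inl j) =
    ((ContinuousLinearMap.proj (R := ℝ) (φ := fun _ : Fin 3 => ℝ) j).comp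
      (ContinuousLinearMap.fst ℝ R3 R3)) := by ext y; rfl
  simp only [pd]
  rw [h, ContinuousLinearMap.fderiv]
  simp [Pi.single_apply]

lemma pd_coord_r (i j : Fin 3) (x : St) :
    pd (.inr i) (coordFn (.inl j)) x = 0 := by
  have h : coordFn (.inl j) =
    ((ContinuousLinearMap.proj (R := ℝ) (φ := fun _ : Fin 3 => ℝ) j).comp
      (ContinuousLinearMap.fst ℝ R3 R3)) := by ext y; rfl
  simp only [pd]
  rw [h, ContinuousLinearMap.fderiv]
  simp

section
variable (a : R3) (d c : ℝ) (x : St)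

lemma pdr (hg : 0 < 1 - d * dot3 x.1 (Aapp a x.1))
    (hs : 0 < x.1 0 ^ 2 + x.1 1 ^ 2)
    (hnu : nuf a d x.1 ≠ 0) (i k : Fin 3) :
    pd (.inr k) (Lvar a d c i) x
      = (gfun a d x.1)⁻¹ * ((if i = k then 1 else 0) - x.1 k * wf a d i x.1) := by
  simp only [pd, pdL a d c i x hg hs hnu, dL]
  have : du i x.1 0 = 0 := by simp [du]; fin_cases i <;> simp
  have h2 : dw a d i x.1 0 = 0 := by simp [dw, dnu, dq, dot3]; fin_cases i <;> simp
  rw [this, h2]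
  simp [dot3, Pi.single_apply]

lemma pdl (hg : 0 < 1 - d * dot3 x.1 (Aapp a x.1))
    (hs : 0 < x.1 0 ^ 2 + x.1 1 ^ 2)
    (hnu : nuf a d x.1 ≠ 0) (i k : Fin 3) :
    pd (.inl k) (Lvar a d c i) x
      = (gfun a d x.1)⁻¹ * ((1 - d * dot3 x.1 (Aapp a x.1))⁻¹ * (d * (a k * x.1 k)) *
    (x.2 i - dot3 x.1 x.2 * wf a d i x.1)
   - x.2 k * wf a d i x.1 - dot3 x.1 x.2 * dw a d i x.1 (Pi.single k 1))
  + c * du i x.1 (Pi.single k 1) := by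
  simp only [pd, pdL a d c i x hg hs hnu, dL]
  simp [dot3, Pi.single_apply, Aapp]
  left; ring

end

lemma second (a : R3) (d c : ℝ) (x : St)
    (hg : 0 < 1 - d * dot3 x.1 (Aapp a x.1))
    (hs : 0 < x.1 0 ^ 2 + x.1 1 ^ 2)
    (hnu : nuf a d x.1 ≠ 0) (i j : Fin 3) :
    pb (piG a d) (Lvar a d c i) (coordFn (.inl j)) x = ∑ k, eps i j k * x.1 k := by
  have hgp : gfun a d x.1 ≠ 0 := (Real.sqrt_pos.2 hg).ne'
  rw [pb_expand]
  simp only [pd_coord_l, pd_coord_r, pdr a d c x hg hs hnu, Fin.sum_univ_three]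
  generalize gfun a d x.1 = g at *
  fin_cases i <;> fin_cases j <;> simp [eps_vals, hgp] <;> ring_nf <;> try field_simp

lemma third (a : R3) (d c : ℝ) (x : St)
    (hs : 0 < x.1 0 ^ 2 + x.1 1 ^ 2)
    (hnu : nuf a d x.1 ≠ 0) :
    dot3 x.1 (fun i => Lvar a d c i x) = c := by
  simp only [L_eq a d c _ x hs hnu]
  have hw : x.1 0 * wf a d 0 x.1 + x.1 1 * wf a d 1 x.1 + x.1 2 * wf a d 2 x.1 = 1 := by
    simp [wf]; field_simp; simp [nuf, qf, dot3, Fin.sum_univ_three]; ring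
  have hu : x.1 0 * uf 0 x.1 + x.1 1 * uf 1 x.1 + x.1 2 * uf 2 x.1 = 1 := by
    simp [uf]; field_simp
  simp only [dot3, Lsim, Fin.sum_univ_three]
  linear_combination c * hu - (gfun a d x.1)⁻¹ *
    (x.1 0 * x.2 0 + x.1 1 * x.2 1 + x.1 2 * x.2 2) * hw

/-- The bracket of two of the functions, with powers of g separated. -/
lemma pbL (a : R3) (d c : ℝ) (x : St)
    (hg : 0 < 1 - d * dot3 x.1 (Aapp a x.1))
    (hs : 0 < x.1 0 ^ 2 + x.1 1 ^ 2)
    (hnu : nuf a d x.1 ≠ 0) (i j : Fin 3) (T S G B : ℝ) 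
    (hG : G = 1 - d * dot3 x.1 (Aapp a x.1)) (hB : B = dot3 x.1 x.2)
    (w : Fin 3 → ℝ) (hw : w = fun i => wf a d i x.1)
    (D : Fin 3 → Fin 3 → ℝ) (hD : D = fun i k => dw a d i x.1 (Pi.single k 1))
    (E : Fin 3 → Fin 3 → ℝ) (hE : E = fun i k => du i x.1 (Pi.single k 1))
    (m : Fin 3 → Fin 3 → ℝ) (hm : m = fun i k => (if i = k then 1 else 0) - x.1 k * w i)
    (l : Fin 3 → Fin 3 → ℝ) (hl : l = fun i k => d * (a k * x.1 k) * (x.2 i - B * w i)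
      + G * (- x.2 k * w i - B * D i k))
    (hT : x.1 2 * (m i 0 * l j 1 - m i 1 * l j 0 + l i 0 * m j 1 - l i 1 * m j 0)
      + x.1 0 * (m i 1 * l j 2 - m i 2 * l j 1 + l i 1 * m j 2 - l i 2 * m j 1)
      + x.1 1 * (m i 2 * l j 0 - m i 0 * l j 2 + l i 2 * m j 0 - l i 0 * m j 2)
      + ((G * x.2 2 - d * dot3 x.2 (Aapp a x.1) * x.1 2) * (m i 0 * m j 1 - m i 1 * m j 0)
      + (G * x.2 0 - d * dot3 x.2 (Aapp a x.1) * x.1 0) * (m i 1 * m j 2 - m i 2 * m j 1)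
      + (G * x.2 1 - d * dot3 x.2 (Aapp a x.1) * x.1 1) * (m i 2 * m j 0 - m i 0 * m j 2))
      = G * T)
    (hS : x.1 2 * (m i 0 * E j 1 - m i 1 * E j 0 + E i 0 * m j 1 - E i 1 * m j 0)
      + x.1 0 * (m i 1 * E j 2 - m i 2 * E j 1 + E i 1 * m j 2 - E i 2 * m j 1)
      + x.1 1 * (m i 2 * E j 0 - m i 0 * E j 2 + E i 2 * m j 0 - E i 0 * m j 2) = S) :
    pb (piG a d) (Lvar a d c i) (Lvar a d c j) x = (gfun a d x.1)⁻¹ * T + c * S := by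
  have hgp : gfun a d x.1 ≠ 0 := (Real.sqrt_pos.2 hg).ne'
  have hg2 : G = gfun a d x.1 ^ 2 := hG ▸ (Real.sq_sqrt hg.le).symm
  have pr : ∀ i k, pd (.inr k) (Lvar a d c i) x = (gfun a d x.1)⁻¹ * m i k := fun i k => by
    rw [pdr a d c x hg hs hnu, hm, hw]
  have pl : ∀ i k, pd (.inl k) (Lvar a d c i) x = (gfun a d x.1)⁻¹ ^ 3 * l i k + c * E i k :=
    fun i k => by
      rw [pdl a d c x hg hs hnu, hl, hE, ← hG, ← hB, hD, hw, hg2]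
      field_simp
      ring
  rw [pb_expand]
  simp only [pr, pl]
  clear pr pl hl hm hE hD hw hB hG
  generalize gfun a d x.1 = g at *
  subst hg2
  have hT' : T = (g⁻¹) ^ 2 * (g ^ 2 * T) := by field_simp
  rw [hT', ← hT, ← hS]
  field_simp
  ring

lemma first01 (a : R3) (d c : ℝ) (x : St)
    (hg : 0 < 1 - d * dot3 x.1 (Aapp a x.1))
    (hs : 0 < x.1 0 ^ 2 + x.1 1 ^ 2)
    (hnu : nuf a d x.1 ≠ 0) :
    pb (piG a d) (Lvar a d c 0) (Lvar a d c 1) x = Lvar a d c 2 x := by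
  rw [L_eq a d c _ x hs hnu]
  refine pbL a d c x hg hs hnu 0 1 _ _ _ _ rfl rfl _ rfl _ rfl _ rfl _ rfl _ rfl ?_ ?_
  · simp [wf, dw, dnu, dq, dot3, Fin.sum_univ_three, Aapp]
    generalize hN : nuf a d x.1 = N at *
    generalize hq : qf a x.1 = q at *
    field_simp
    subst hN
    subst hq
    simp only [qf, nuf, dot3, Fin.sum_univ_three]
    ring
  · simp [du, uf, wf]
    field_simp
    ring

lemma first12 (a : R3) (d c : ℝ) (x : St)
    (hg : 0 < 1 - d * dot3 x.1 (Aapp a x.1))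
    (hs : 0 < x.1 0 ^ 2 + x.1 1 ^ 2)
    (hnu : nuf a d x.1 ≠ 0) :
    pb (piG a d) (Lvar a d c 1) (Lvar a d c 2) x = Lvar a d c 0 x := by
  rw [L_eq a d c _ x hs hnu]
  refine pbL a d c x hg hs hnu 1 2 _ _ _ _ rfl rfl _ rfl _ rfl _ rfl _ rfl _ rfl ?_ ?_
  · simp [wf, dw, dnu, dq, dot3, Fin.sum_univ_three, Aapp]
    generalize hN : nuf a d x.1 = N at *
    generalize hq : qf a x.1 = q at *
    field_simp
    subst hN
    subst hq
    simp only [qf, nuf, dot3, Fin.sum_univ_three]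
    ring
  · simp [du, uf, wf]
    field_simp
    ring

lemma first20 (a : R3) (d c : ℝ) (x : St)
    (hg : 0 < 1 - d * dot3 x.1 (Aapp a x.1))
    (hs : 0 < x.1 0 ^ 2 + x.1 1 ^ 2)
    (hnu : nuf a d x.1 ≠ 0) :
    pb (piG a d) (Lvar a d c 2) (Lvar a d c 0) x = Lvar a d c 1 x := by
  rw [L_eq a d c _ x hs hnu]
  refine pbL a d c x hg hs hnu 2 0 _ _ _ _ rfl rfl _ rfl _ rfl _ rfl _ rfl _ rfl ?_ ?_
  · simp [wf, dw, dnu, dq, dot3, Fin.sum_univ_three, Aapp]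
    generalize hN : nuf a d x.1 = N at *
    generalize hq : qf a x.1 = q at *
    field_simp
    subst hN
    subst hq
    simp only [qf, nuf, dot3, Fin.sum_univ_three]
    ring
  · simp [du, uf, wf]
    field_simp
    ring

/-- the change of variables L transforms the deformed bracket
{·,·}_g into the canonical Lie-Poisson bracket on e*(3), with c = (γ, L). -/
theorem reduction_to_canonical_e3
    (a : R3) (d c : ℝ) (hd : 0 < d)
    (x : St)
    (hg : 0 < 1 - d * dot3 x.1 (Aapp a x.1))
    (hplane : 0 < x.1 0 ^ 2 + x.1 1 ^ 2)
    (hnu : nuf a d x.1 ≠ 0) :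
    (∀ i j : Fin 3,
      pb (piG a d) (Lvar a d c i) (Lvar a d c j) x = ∑ k, eps i j k * Lvar a d c k x) ∧
    (∀ i j : Fin 3,
      pb (piG a d) (Lvar a d c i) (coordFn (.inl j)) x = ∑ k, eps i j k * x.1 k) ∧
    dot3 x.1 (fun i => Lvar a d c i x) = c := by
  have e01 := first01 a d c x hg hplane hnu
  have e12 := first12 a d c x hg hplane hnu
  have e20 := first20 a d c x hg hplane hnu
  have e10 := pb_anti a d x (Lvar a d c 1) (Lvar a d c 0)
  have e21 := pb_anti a d x (Lvar a d c 2) (Lvar a d c 1)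
  have e02 := pb_anti a d x (Lvar a d c 0) (Lvar a d c 2)
  have e00 := pb_anti a d x (Lvar a d c 0) (Lvar a d c 0)
  have e11 := pb_anti a d x (Lvar a d c 1) (Lvar a d c 1)
  have e22 := pb_anti a d x (Lvar a d c 2) (Lvar a d c 2)
  refine ⟨fun i j => ?_, second a d c x hg hplane hnu, third a d c x hplane hnu⟩
  fin_cases i <;> fin_cases j <;> simp [eps_vals, Fin.sum_univ_three] <;> linarith
end
end
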